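/- arXiv:1208.6287 — 15 statements merged into one kernel-verified Lean document; each statement's English description precedes it below -/
import Mathlib

section
/- In the abstract KBc algebra, for all scalars γ₁, γ₂, β ∈ ℝ, the element Ψ = γ₁·c·K + γ₂·K·c + β·c·K·B·c satisfies Q(Ψ) + Ψ·Ψ = γ₁·(1+γ₁)·c·K·c·K + (γ₂·(1+γ₂) + β·(γ₂−γ₁))·K·c·K·c + γ₁·(γ₂+β)·c·K·K·c + β·(γ₁−γ₂)·B·c·K·c·K·c. -/
theorem stmt0 {A : Type*} [Ring A] [Algebra ℝ A]
    (σ : A →ₐ[ℝ] A) (hσ : ∀ x, σ (σ x) = x)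
    (Q : A →ₗ[ℝ] A) (hQmul : ∀ x y, Q (x * y) = Q x * y + σ x * Q y)
    (K B c : A)
    (hσK : σ K = K) (hσB : σ B = -B) (hσc : σ c = -c)
    (hKB : K * B = B * K) (hBB : B * B = 0) (hcc : c * c = 0)
    (hcB : c * B + B * c = 1)
    (hQK : Q K = 0) (hQB : Q B = K) (hQc : Q c = c * K * c)
    (γ₁ γ₂ β : ℝ) :
    Q (γ₁ • (c * K) + γ₂ • (K * c) + β • (c * K * B * c)) +
      (γ₁ • (c * K) + γ₂ • (K * c) + β • (c * K * B * c)) *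
        (γ₁ • (c * K) + γ₂ • (K * c) + β • (c * K * B * c)) =
    (γ₁ * (1 + γ₁)) • (c * K * c * K) +
      (γ₂ * (1 + γ₂) + β * (γ₂ - γ₁)) • (K * c * K * c) +
      (γ₁ * (γ₂ + β)) • (c * K * K * c) +
      (β * (γ₁ - γ₂)) • (B * c * K * c * K * c) := by
  have hcB' : c * B = 1 - B * c := eq_sub_of_add_eq hcB
  have hZ : c * K * B * c = K * c - B * c * K * c := by
    rw [mul_assoc c K B, hKB, ← mul_assoc, hcB']
    noncomm_ring
  have hQX : Q (c * K) = c * K * c * K := by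
    rw [hQmul, hQc, hQK, mul_zero, add_zero]
  have hQY : Q (K * c) = K * c * K * c := by
    rw [hQmul, hQc, hQK, zero_mul, zero_add, hσK]
    simp only [mul_assoc]
  have hQcKc : Q (c * K * c) = 0 := by
    rw [hQmul, hQX, hQc, map_mul, hσc, hσK]
    noncomm_ring
  have hQZ : Q (c * K * B * c) = 0 := by
    have hW : B * c * K * c = B * (c * K * c) := by simp only [mul_assoc]
    rw [hZ, map_sub, hQY, hW, hQmul, hQB, hQcKc]
    simp only [mul_assoc, mul_zero, add_zero, sub_self]
  have hcc' (x : A) : x * c * c = 0 := by rw [mul_assoc, hcc, mul_zero]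
  have hZY : c * K * B * c * (K * c) = K * c * K * c - B * c * K * c * K * c := by
    rw [hZ]
    noncomm_ring
  have hXZ : c * K * (c * K * B * c) =
      c * K * K * c - K * c * K * c + B * c * K * c * K * c := by
    calc c * K * (c * K * B * c) = c * K * K * c - c * K * B * c * (K * c) := by
          conv_lhs => rw [hZ]
          noncomm_ring
      _ = _ := by
          rw [hZY]
          abel
  have hXX : c * K * (c * K) = c * K * c * K := by simp only [mul_assoc]
  have hXY : c * K * (K * c) = c * K * K * c := by simp only [mul_assoc]
  have hYX : K * c * (c * K) = 0 := by rw [← mul_assoc, hcc', zero_mul]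
  have hYY : K * c * (K * c) = K * c * K * c := by simp only [mul_assoc]
  have hYZ : K * c * (c * K * B * c) = 0 := by
    simp only [← mul_assoc, hcc', zero_mul]
  have hZX : c * K * B * c * (c * K) = 0 := by rw [← mul_assoc, hcc', zero_mul]
  have hZZ : c * K * B * c * (c * K * B * c) = 0 := by
    simp only [← mul_assoc, hcc', zero_mul]
  simp only [map_add, map_smul, hQX, hQY, hQZ, add_mul, mul_add, smul_mul_assoc,
    mul_smul_comm, hXX, hXY, hXZ, hYX, hYY, hYZ, hZX, hZY, hZZ]
  module
end

section
/- In the abstract KBc algebra, assume that the four elements c·K·c·K, K·c·K·c, c·K·K·c, and B·c·K·c·K·c are linearly independent over ℝ. Then for scalars γ₁, γ₂, β ∈ ℝ, the element Ψ = γ₁·c·K + γ₂·K·c + β·c·K·B·c satisfies Q(Ψ) + Ψ·Ψ = 0 if and only if either γ₁ = γ₂ = 0 (with β arbitrary), or (γ₁, γ₂, β) = (−1, 0, 0), or (γ₁, γ₂, β) = (0, −1, 0), or (γ₁, γ₂, β) = (−1, −1, 1). -/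
theorem stmt1 {A : Type*} [Ring A] [Algebra ℝ A]
    (σ : A →ₐ[ℝ] A) (hσ : ∀ x, σ (σ x) = x)
    (Q : A →ₗ[ℝ] A) (hQmul : ∀ x y, Q (x * y) = Q x * y + σ x * Q y)
    (K B c : A)
    (hσK : σ K = K) (hσB : σ B = -B) (hσc : σ c = -c)
    (hKB : K * B = B * K) (hBB : B * B = 0) (hcc : c * c = 0)
    (hcB : c * B + B * c = 1)
    (hQK : Q K = 0) (hQB : Q B = K) (hQc : Q c = c * K * c)
    (hli : LinearIndependent ℝ
      ![c * K * c * K, K * c * K * c, c * K * K * c, B * c * K * c * K * c])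
    (γ₁ γ₂ β : ℝ) :
    Q (γ₁ • (c * K) + γ₂ • (K * c) + β • (c * K * B * c)) +
      (γ₁ • (c * K) + γ₂ • (K * c) + β • (c * K * B * c)) *
        (γ₁ • (c * K) + γ₂ • (K * c) + β • (c * K * B * c)) = 0 ↔
    (γ₁ = 0 ∧ γ₂ = 0) ∨ (γ₁ = -1 ∧ γ₂ = 0 ∧ β = 0) ∨
      (γ₁ = 0 ∧ γ₂ = -1 ∧ β = 0) ∨ (γ₁ = -1 ∧ γ₂ = -1 ∧ β = 1) := by
  have hcc' : ∀ x, c * (c * x) = 0 := fun x => by rw [← mul_assoc, hcc, zero_mul]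
  have hcB' : c * B = 1 - B * c := eq_sub_of_add_eq hcB
  have hcBx : ∀ x, c * (B * x) = x - B * (c * x) := fun x => by
    rw [← mul_assoc, hcB', sub_mul, one_mul, mul_assoc]
  have hKBx : ∀ x, K * (B * x) = B * (K * x) := fun x => by
    rw [← mul_assoc, hKB, mul_assoc]
  have expansion : Q (γ₁ • (c * K) + γ₂ • (K * c) + β • (c * K * B * c)) +
      (γ₁ • (c * K) + γ₂ • (K * c) + β • (c * K * B * c)) *
        (γ₁ • (c * K) + γ₂ • (K * c) + β • (c * K * B * c)) =
      (γ₁ * (1 + γ₁)) • (c * K * c * K) +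
      (γ₂ * (1 + γ₂) + β * (γ₂ - γ₁)) • (K * c * K * c) +
      (γ₁ * (γ₂ + β)) • (c * K * K * c) +
      (β * (γ₁ - γ₂)) • (B * c * K * c * K * c) := by
    simp only [map_add, map_sub, map_smul, hQmul, hσK, hσB, hσc, hQK, hQB, hQc,
      mul_add, add_mul, smul_mul_assoc, mul_smul_comm, mul_assoc, hcc', hcBx, hKBx,
      mul_zero, zero_mul, neg_mul, mul_neg, mul_sub, sub_mul, add_zero, zero_add,
      smul_zero, sub_zero, neg_neg]
    module
  rw [expansion]
  constructor
  · intro h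
    have hcoeff := Fintype.linearIndependent_iff.mp hli
      ![γ₁ * (1 + γ₁), γ₂ * (1 + γ₂) + β * (γ₂ - γ₁), γ₁ * (γ₂ + β), β * (γ₁ - γ₂)]
      (by simpa [Fin.sum_univ_four] using h)
    have h₀ : γ₁ * (1 + γ₁) = 0 := hcoeff 0
    have h₁ : γ₂ * (1 + γ₂) + β * (γ₂ - γ₁) = 0 := hcoeff 1
    have h₂ : γ₁ * (γ₂ + β) = 0 := hcoeff 2
    have h₃ : β * (γ₁ - γ₂) = 0 := hcoeff 3
    grind
  · rintro (⟨rfl, rfl⟩ | ⟨rfl, rfl, rfl⟩ | ⟨rfl, rfl, rfl⟩ | ⟨rfl, rfl, rfl⟩) <;> simp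
end

section
/- In the abstract KBc algebra, one has Q(B·c) = c·K·B·c; consequently Q(c·K·B·c) = 0 and (c·K·B·c)·(c·K·B·c) = 0, so that for every scalar β ∈ ℝ the element Ψ = β·c·K·B·c satisfies Q(Ψ) + Ψ·Ψ = 0. -/
theorem stmt2 {A : Type*} [Ring A] [Algebra ℝ A]
    (σ : A →ₐ[ℝ] A) (hσ : ∀ x, σ (σ x) = x)
    (Q : A →ₗ[ℝ] A) (hQmul : ∀ x y, Q (x * y) = Q x * y + σ x * Q y)
    (K B c : A)
    (hσK : σ K = K) (hσB : σ B = -B) (hσc : σ c = -c)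
    (hKB : K * B = B * K) (hBB : B * B = 0) (hcc : c * c = 0)
    (hcB : c * B + B * c = 1)
    (hQK : Q K = 0) (hQB : Q B = K) (hQc : Q c = c * K * c) :
    Q (B * c) = c * K * B * c ∧ Q (c * K * B * c) = 0 ∧
      (c * K * B * c) * (c * K * B * c) = 0 ∧
      ∀ β : ℝ, Q (β • (c * K * B * c)) +
        (β • (c * K * B * c)) * (β • (c * K * B * c)) = 0 := by
  have hBc : B * c = 1 - c * B := eq_sub_of_add_eq' hcB
  have h₁ : Q (B * c) = c * K * B * c := by
    calc Q (B * c) = K * c - B * c * (K * c) := by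
          rw [hQmul, hQB, hσB, hQc]
          noncomm_ring
      _ = c * (B * K) * c := by
          rw [hBc]
          noncomm_ring
      _ = c * K * B * c := by rw [← hKB, ← mul_assoc c K B]
  have h₂ : Q (c * K * B * c) = 0 := by
    have h : c * K * B * c = c * (K * (B * c)) := by simp only [mul_assoc]
    rw [h, hQmul, hQmul K, hQc, hQK, hσc, hσK, h₁]
    noncomm_ring
  have h₃ : (c * K * B * c) * (c * K * B * c) = 0 := by
    calc (c * K * B * c) * (c * K * B * c) = c * K * B * (c * c) * (K * B * c) := by
          simp only [mul_assoc]
      _ = 0 := by rw [hcc, mul_zero, zero_mul]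
  refine ⟨h₁, h₂, h₃, fun β => ?_⟩
  rw [map_smul, h₂, smul_mul_smul_comm, h₃, smul_zero, smul_zero, add_zero]
end

section
/- In the abstract KBc algebra, the MNT ghost brane Ψ = −c·K − K·c + c·K·B·c satisfies the equation of motion Q(Ψ) + Ψ·Ψ = 0. -/
theorem stmt4 {A : Type*} [Ring A] [Algebra ℝ A]
    (σ : A →ₐ[ℝ] A) (hσ : ∀ x, σ (σ x) = x)
    (Q : A →ₗ[ℝ] A) (hQmul : ∀ x y, Q (x * y) = Q x * y + σ x * Q y)
    (K B c : A)
    (hσK : σ K = K) (hσB : σ B = -B) (hσc : σ c = -c)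
    (hKB : K * B = B * K) (hBB : B * B = 0) (hcc : c * c = 0)
    (hcB : c * B + B * c = 1)
    (hQK : Q K = 0) (hQB : Q B = K) (hQc : Q c = c * K * c) :
    Q (-(c * K) - K * c + c * K * B * c) +
      (-(c * K) - K * c + c * K * B * c) * (-(c * K) - K * c + c * K * B * c) = 0 := by
  have hcc' : ∀ x, c * (c * x) = 0 := fun x => by rw [← mul_assoc, hcc, zero_mul]
  simp only [map_add, map_sub, map_neg, hQmul, hσK, hσc, hσB, hQK, hQB, hQc,
    mul_add, add_mul, mul_sub, sub_mul, neg_mul, mul_neg, neg_neg, mul_zero, zero_mul,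
    mul_assoc, hcc', add_zero, zero_add, sub_zero]
  abel
end

section
/- In the abstract KBc algebra, assume in addition the auxiliary identity (∂c)·(∂c) = 0, where ∂c := K·c − c·K. Then for all scalars γ₁, γ₂ ∈ ℝ, the element Ψ = γ₁·c·K + γ₂·K·c − (1+γ₁+γ₂)·c·K·B·c satisfies the equation of motion Q(Ψ) + Ψ·Ψ = 0. -/
theorem stmt5 {A : Type*} [Ring A] [Algebra ℝ A]
    (σ : A →ₐ[ℝ] A) (hσ : ∀ x, σ (σ x) = x)
    (Q : A →ₗ[ℝ] A) (hQmul : ∀ x y, Q (x * y) = Q x * y + σ x * Q y)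
    (K B c : A)
    (hσK : σ K = K) (hσB : σ B = -B) (hσc : σ c = -c)
    (hKB : K * B = B * K) (hBB : B * B = 0) (hcc : c * c = 0)
    (hcB : c * B + B * c = 1)
    (hQK : Q K = 0) (hQB : Q B = K) (hQc : Q c = c * K * c)
    (haux : (K * c - c * K) * (K * c - c * K) = 0)
    (γ₁ γ₂ : ℝ) :
    Q (γ₁ • (c * K) + γ₂ • (K * c) - (1 + γ₁ + γ₂) • (c * K * B * c)) +
      (γ₁ • (c * K) + γ₂ • (K * c) - (1 + γ₁ + γ₂) • (c * K * B * c)) *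
        (γ₁ • (c * K) + γ₂ • (K * c) - (1 + γ₁ + γ₂) • (c * K * B * c)) = 0 := by
  have hcc' : ∀ x, c * (c * x) = 0 := fun x => by rw [← mul_assoc, hcc, zero_mul]
  have hsum : c * (K * (K * c)) = c * (K * (c * K)) + K * (c * (K * c)) := by
    simp only [sub_mul, mul_sub, mul_assoc, hcc', mul_zero] at haux
    rw [← sub_eq_zero, ← neg_eq_zero, ← haux]
    abel
  have hcKcKc : c * (K * (c * (K * c))) = 0 := by
    have h := congrArg (c * ·) hsum
    simpa [mul_add, hcc'] using h.symm
  have hBc : B * c = 1 - c * B := eq_sub_of_add_eq' hcB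
  have hcB' : c * B = 1 - B * c := eq_sub_of_add_eq hcB
  have hright : c * (K * (c * (K * (B * c)))) = c * (K * (c * K)) := by
    have h : c * (K * (c * (K * (c * B)))) = 0 := by
      simpa [mul_assoc] using congrArg (· * B) hcKcKc
    rw [hBc]
    simp only [mul_sub, mul_one, h, sub_zero]
  have hleft : c * (K * (B * (c * (K * c)))) = K * (c * (K * c)) := by
    rw [← mul_assoc K B, hKB, mul_assoc, ← mul_assoc c B, hcB', sub_mul, one_mul, mul_assoc,
      hcKcKc, mul_zero, sub_zero]
  simp only [map_sub, map_add, map_smul, hQmul, hQK, hQB, hQc, hσK, hσB, hσc,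
    mul_add, add_mul, mul_sub, sub_mul, smul_mul_assoc, mul_smul_comm, mul_assoc, hcc',
    neg_mul, mul_neg, mul_zero, zero_mul, smul_zero, hright, hleft, hsum]
  module
end

section
/- Let A be an associative unital ring, K, c ∈ A, and write ∂x := K·x − x·K, with ∂⁰c := c and ∂^{m+1}c := ∂(∂^m c). If c·c = 0 and (∂^m c)·(∂^m c) = 0 for every integer m ≥ 1, then ∂^m c · ∂^n c + ∂^n c · ∂^m c = 0 for all integers m, n ≥ 0. -/
/-- If every term of a sequence of iterated commutators with `K` squares to zero, then the terms
anticommute pairwise. -/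
theorem anticommute_add_of_sq_eq_zero {A : Type*} [Ring A] {K : A} {d : ℕ → A}
    (hd : ∀ m, d (m + 1) = K * d m - d m * K) (hsq : ∀ m, d m * d m = 0) (m k : ℕ) :
    d m * d (m + k) + d (m + k) * d m = 0 := by
  induction k using Nat.twoStepInduction generalizing m with
  | zero => simp [hsq]
  | one =>
    calc d m * d (m + 1) + d (m + 1) * d m
        = K * (d m * d m) - (d m * d m) * K := by rw [hd]; noncomm_ring
      _ = 0 := by simp [hsq]
  | more k ih₀ ih₁ =>
    have h₀ := ih₀ (m + 1)
    have h₁ := ih₁ m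
    rw [show m + 1 + k = m + (k + 1) by ring] at h₀
    have leibniz : d m * d (m + (k + 2)) + d (m + (k + 2)) * d m =
        K * (d m * d (m + (k + 1)) + d (m + (k + 1)) * d m) -
          (d m * d (m + (k + 1)) + d (m + (k + 1)) * d m) * K -
          (d (m + 1) * d (m + (k + 1)) + d (m + (k + 1)) * d (m + 1)) := by
      rw [show m + (k + 2) = m + (k + 1) + 1 by ring, hd (m + (k + 1)), hd m]
      noncomm_ring
    rw [leibniz, h₀, h₁]
    simp

theorem stmt6 {A : Type*} [Ring A] (K c : A)
    (hcc : c * c = 0)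
    (haux : ∀ m : ℕ, 1 ≤ m →
      (fun x => K * x - x * K)^[m] c * (fun x => K * x - x * K)^[m] c = 0) :
    ∀ m n : ℕ,
      (fun x => K * x - x * K)^[m] c * (fun x => K * x - x * K)^[n] c +
        (fun x => K * x - x * K)^[n] c * (fun x => K * x - x * K)^[m] c = 0 := by
  have hsq : ∀ m : ℕ,
      (fun x => K * x - x * K)^[m] c * (fun x => K * x - x * K)^[m] c = 0
    | 0 => hcc
    | m + 1 => haux (m + 1) m.succ_pos
  have anticomm := anticommute_add_of_sq_eq_zero (K := K)
    (d := fun m => (fun x => K * x - x * K)^[m] c)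
    (fun m => Function.iterate_succ_apply' _ m c) hsq
  intro m n
  rcases le_total m n with h | h
  · obtain ⟨k, rfl⟩ := Nat.exists_eq_add_of_le h
    exact anticomm m k
  · obtain ⟨k, rfl⟩ := Nat.exists_eq_add_of_le h
    rw [add_comm]
    exact anticomm n k
end

section
/- In the abstract KBc algebra, let G ∈ A be invertible with σ(G) = G, Q(G) = 0, G·K = K·G, and G·B = B·G. Define K̂ := K·G, B̂ := B·G, and ĉ := c·G⁻¹·B·c. Then K̂, B̂, ĉ again satisfy all defining relations of the KBc algebra: σ(K̂) = K̂, σ(B̂) = −B̂, σ(ĉ) = −ĉ, K̂·B̂ = B̂·K̂, B̂·B̂ = 0, ĉ·ĉ = 0, ĉ·B̂ + B̂·ĉ = 1, Q(K̂) = 0, Q(B̂) = K̂, and Q(ĉ) = ĉ·K̂·ĉ. -/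
theorem stmt7 {A : Type*} [Ring A] [Algebra ℝ A]
    (σ : A →ₐ[ℝ] A) (hσ : ∀ x, σ (σ x) = x)
    (Q : A →ₗ[ℝ] A) (hQmul : ∀ x y, Q (x * y) = Q x * y + σ x * Q y)
    (K B c : A)
    (hσK : σ K = K) (hσB : σ B = -B) (hσc : σ c = -c)
    (hKB : K * B = B * K) (hBB : B * B = 0) (hcc : c * c = 0)
    (hcB : c * B + B * c = 1)
    (hQK : Q K = 0) (hQB : Q B = K) (hQc : Q c = c * K * c)
    (G Gi : A) (hGGi : G * Gi = 1) (hGiG : Gi * G = 1)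
    (hσG : σ G = G) (hQG : Q G = 0) (hGK : G * K = K * G) (hGB : G * B = B * G) :
    σ (K * G) = K * G ∧ σ (B * G) = -(B * G) ∧
      σ (c * Gi * B * c) = -(c * Gi * B * c) ∧
      (K * G) * (B * G) = (B * G) * (K * G) ∧
      (B * G) * (B * G) = 0 ∧
      (c * Gi * B * c) * (c * Gi * B * c) = 0 ∧
      (c * Gi * B * c) * (B * G) + (B * G) * (c * Gi * B * c) = 1 ∧
      Q (K * G) = 0 ∧ Q (B * G) = K * G ∧
      Q (c * Gi * B * c) = (c * Gi * B * c) * (K * G) * (c * Gi * B * c) := by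
  have hBcB : B * c * B = B := by
    have h := congrArg (· * B) hcB
    simpa [add_mul, mul_assoc, hBB] using h
  have hGiK : Gi * K = K * Gi := by
    have h : Gi * (G * K) * Gi = Gi * (K * G) * Gi := by rw [hGK]
    simpa [mul_assoc, hGGi, ← mul_assoc Gi G, hGiG] using h.symm
  have hGiB : Gi * B = B * Gi := by
    have h : Gi * (G * B) * Gi = Gi * (B * G) * Gi := by rw [hGB]
    simpa [mul_assoc, hGGi, ← mul_assoc Gi G, hGiG] using h.symm
  have hσGi : σ Gi = Gi := by
    have h : G * σ Gi = 1 := by rw [← map_one σ, ← hGGi, map_mul, hσG]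
    exact (left_inv_eq_right_inv hGiG h).symm
  have hQ1 : Q 1 = 0 := by simpa using hQmul 1 1
  have hQGi : Q Gi = 0 := by
    have h : G * Q Gi = 0 := by simpa [hGGi, hQ1, hQG, hσG] using (hQmul G Gi).symm
    calc Q Gi = Gi * (G * Q Gi) := by rw [← mul_assoc, hGiG, one_mul]
      _ = 0 := by rw [h, mul_zero]
  have hright : c * Gi * B * c * (B * G) = c * B := by
    calc c * Gi * B * c * (B * G) = c * Gi * (B * c * B) * G := by noncomm_ring
      _ = c * Gi * (G * B) := by rw [hBcB, hGB, mul_assoc]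
      _ = c * (Gi * G) * B := by noncomm_ring
      _ = c * B := by rw [hGiG, mul_one]
  have hleft : B * G * (c * Gi * B * c) = B * c := by
    calc B * G * (c * Gi * B * c) = (B * G) * c * (Gi * B) * c := by noncomm_ring
      _ = (G * B) * c * (B * Gi) * c := by rw [hGB, hGiB]
      _ = G * (B * c * B) * Gi * c := by noncomm_ring
      _ = (G * B) * Gi * c := by rw [hBcB]
      _ = B * (G * Gi) * c := by rw [hGB]; noncomm_ring
      _ = B * c := by rw [hGGi, mul_one]
  have hBc : B * c = 1 - c * B := eq_sub_of_add_eq' hcB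
  refine ⟨by simp [hσK, hσG], by simp [hσB, hσG], by simp [hσc, hσB, hσGi], ?_, ?_, ?_, ?_,
    by simp [hQmul, hQK, hQG], by simp [hQmul, hQB, hQG], ?_⟩
  · calc K * G * (B * G) = K * (G * B) * G := by noncomm_ring
      _ = (K * B) * G * G := by rw [hGB]; noncomm_ring
      _ = B * (K * G) * G := by rw [hKB]; noncomm_ring
      _ = B * G * (K * G) := by rw [mul_assoc B G, ← mul_assoc G K, hGK, mul_assoc B]
  · calc B * G * (B * G) = B * (G * B) * G := by noncomm_ring
      _ = (B * B) * G * G := by rw [hGB]; noncomm_ring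
      _ = 0 := by rw [hBB, zero_mul, zero_mul]
  · calc c * Gi * B * c * (c * Gi * B * c) = c * Gi * B * (c * c) * Gi * B * c := by noncomm_ring
      _ = 0 := by simp [hcc]
  · rw [hright, hleft, hcB]
  · have hL : Q (c * Gi * B * c) =
        c * K * c * Gi * B * c - c * Gi * (K * c) + c * Gi * (B * c) * (K * c) := by
      simp only [hQmul, map_mul, hQc, hQGi, hQB, hσc, hσGi, hσB]
      noncomm_ring
    have hR : c * Gi * B * c * (K * G) * (c * Gi * B * c) =
        c * (K * G * Gi) * c * Gi * B * c - c * Gi * c * K * (B * c) := by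
      calc c * Gi * B * c * (K * G) * (c * Gi * B * c)
          = c * Gi * (B * c) * (K * G) * (c * Gi * B * c) := by noncomm_ring
        _ = c * (Gi * K) * G * c * Gi * B * c
            - c * Gi * c * (B * K) * G * (c * Gi * B * c) := by rw [hBc]; noncomm_ring
        _ = c * K * (Gi * G) * c * Gi * B * c
            - c * Gi * c * K * (B * G * (c * Gi * B * c)) := by
          rw [hGiK, ← hKB]; noncomm_ring
        _ = _ := by rw [hleft, hGiG, mul_assoc K, hGGi, mul_one, mul_one]
    have hBcKc : c * Gi * (B * c) * (K * c) = c * Gi * (K * c) - c * Gi * c * K * (B * c) := by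
      calc c * Gi * (B * c) * (K * c) = c * Gi * (K * c) - c * Gi * c * (B * K) * c := by
            rw [hBc]; noncomm_ring
        _ = _ := by rw [← hKB]; noncomm_ring
    rw [hL, hR, hBcKc, mul_assoc K, hGGi, mul_one]
    abel
end

section
/- In the abstract KBc algebra, for all scalars γ₁, γ₂ ∈ ℝ, setting Ψ₀ = γ₁·c·K + γ₂·K·c − (1+γ₁+γ₂)·c·K·B·c, the deformed kinetic operator applied to the odd element B gives Q_{Ψ₀}(B) = Q(B) + Ψ₀·B + B·Ψ₀ = −(1+γ₁+γ₂)·B·∂c, where ∂c := K·c − c·K. -/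
theorem stmt8 {A : Type*} [Ring A] [Algebra ℝ A]
    (σ : A →ₐ[ℝ] A) (hσ : ∀ x, σ (σ x) = x)
    (Q : A →ₗ[ℝ] A) (hQmul : ∀ x y, Q (x * y) = Q x * y + σ x * Q y)
    (K B c : A)
    (hσK : σ K = K) (hσB : σ B = -B) (hσc : σ c = -c)
    (hKB : K * B = B * K) (hBB : B * B = 0) (hcc : c * c = 0)
    (hcB : c * B + B * c = 1)
    (hQK : Q K = 0) (hQB : Q B = K) (hQc : Q c = c * K * c)
    (γ₁ γ₂ : ℝ) :
    Q B + (γ₁ • (c * K) + γ₂ • (K * c) - (1 + γ₁ + γ₂) • (c * K * B * c)) * B +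
      B * (γ₁ • (c * K) + γ₂ • (K * c) - (1 + γ₁ + γ₂) • (c * K * B * c)) =
    (-(1 + γ₁ + γ₂)) • (B * (K * c - c * K)) := by
  have hBcB : B * c * B = B := by
    rw [eq_sub_of_add_eq' hcB, sub_mul, one_mul, mul_assoc, hBB, mul_zero, sub_zero]
  have h₁ : c * K * B + B * (c * K) = K := by
    rw [mul_assoc, hKB, ← mul_assoc, ← mul_assoc, ← add_mul, hcB, one_mul]
  have h₂ : K * c * B + B * (K * c) = K := by
    rw [← mul_assoc B, ← hKB, mul_assoc, mul_assoc, ← mul_add, hcB, mul_one]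
  have h₃ : c * K * B * c * B + B * (c * K * B * c) = K + B * (K * c - c * K) := by
    have hl : c * K * B * c * B = c * K * B := by
      rw [mul_assoc (c * K), mul_assoc (c * K), hBcB]
    have hr : B * (c * K * B * c) = B * (K * c) := by
      calc B * (c * K * B * c) = B * c * (K * B) * c := by simp only [mul_assoc]
        _ = B * c * B * (K * c) := by rw [hKB]; simp only [mul_assoc]
        _ = B * (K * c) := by rw [hBcB]
    rw [hl, hr, mul_sub, eq_sub_of_add_eq h₁]
    abel
  calc
    _ = K + γ₁ • (c * K * B + B * (c * K)) + γ₂ • (K * c * B + B * (K * c))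
        - (1 + γ₁ + γ₂) • (c * K * B * c * B + B * (c * K * B * c)) := by
      rw [hQB]
      simp only [add_mul, sub_mul, mul_add, mul_sub, smul_mul_assoc, mul_smul_comm, smul_add]
      abel
    _ = _ := by
      rw [h₁, h₂, h₃]
      module
end

section
/- In the abstract KBc algebra, the element (∂c)·(∂c)·B is exact for the kinetic operator deformed by the residual tachyon vacuum Ψ = −c·K: one has (∂c)·(∂c)·B = Q_{−c·K}(∂c·B) = Q(∂c·B) + (−c·K)·(∂c·B) − (∂c·B)·(−c·K), where ∂c := K·c − c·K (the element ∂c·B is even). -/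
theorem stmt10 {A : Type*} [Ring A] [Algebra ℝ A]
    (σ : A →ₐ[ℝ] A) (hσ : ∀ x, σ (σ x) = x)
    (Q : A →ₗ[ℝ] A) (hQmul : ∀ x y, Q (x * y) = Q x * y + σ x * Q y)
    (K B c : A)
    (hσK : σ K = K) (hσB : σ B = -B) (hσc : σ c = -c)
    (hKB : K * B = B * K) (hBB : B * B = 0) (hcc : c * c = 0)
    (hcB : c * B + B * c = 1)
    (hQK : Q K = 0) (hQB : Q B = K) (hQc : Q c = c * K * c) :
    (K * c - c * K) * (K * c - c * K) * B =
    Q ((K * c - c * K) * B) + -(c * K) * ((K * c - c * K) * B) -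
      ((K * c - c * K) * B) * -(c * K) := by
  have hBc : B * c = 1 - c * B := eq_sub_of_add_eq' hcB
  have hcBc : c * B * c = c := by
    rw [mul_assoc, hBc, mul_sub, ← mul_assoc, hcc, zero_mul, mul_one, sub_zero]
  have hQ : Q ((K * c - c * K) * B) =
      (K * (c * K * c) - c * K * c * K) * B - (K * c - c * K) * K := by
    simp only [hQmul, map_sub, map_mul, hQK, hQB, hQc, hσK, hσc]
    noncomm_ring
  have hleft : (K * c - c * K) * (K * c - c * K) * B =
      K * c * K * c * B - c * K * K * c * B + c * K * c * (K * B) := by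
    have hzero : K * (c * c) * K * B = 0 := by rw [hcc]; simp
    rw [← sub_eq_zero, ← neg_eq_zero, ← hzero]
    noncomm_ring
  have hright : (K * c - c * K) * B * (c * K) = K * c * K - c * K * K + c * K * c * (B * K) := by
    calc (K * c - c * K) * B * (c * K)
        = K * (c * B * c) * K - c * K * (B * c) * K := by noncomm_ring
      _ = K * c * K - c * K * (1 - c * B) * K := by rw [hcBc, hBc]
      _ = _ := by noncomm_ring
  rw [mul_neg, hright, hQ, hleft, ← hKB]
  noncomm_ring
end

section
/- In the abstract KBc algebra, with Ψ = −c·K − K·c + c·K·B·c (the MNT ghost brane) and ∂c := K·c − c·K, one has the exactness identity K·(∂c)·(∂c)·B = Q_Ψ(K·∂c·B) = Q(K·∂c·B) + Ψ·(K·∂c·B) − (K·∂c·B)·Ψ (the element K·∂c·B is even). -/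
theorem stmt11 {A : Type*} [Ring A] [Algebra ℝ A]
    (σ : A →ₐ[ℝ] A) (hσ : ∀ x, σ (σ x) = x)
    (Q : A →ₗ[ℝ] A) (hQmul : ∀ x y, Q (x * y) = Q x * y + σ x * Q y)
    (K B c : A)
    (hσK : σ K = K) (hσB : σ B = -B) (hσc : σ c = -c)
    (hKB : K * B = B * K) (hBB : B * B = 0) (hcc : c * c = 0)
    (hcB : c * B + B * c = 1)
    (hQK : Q K = 0) (hQB : Q B = K) (hQc : Q c = c * K * c) :
    K * (K * c - c * K) * (K * c - c * K) * B =
    Q (K * (K * c - c * K) * B) +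
      (-(c * K) - K * c + c * K * B * c) * (K * (K * c - c * K) * B) -
      (K * (K * c - c * K) * B) * (-(c * K) - K * c + c * K * B * c) := by
  have hQKc : Q (K * c) = K * (c * K * c) := by rw [hQmul, hQK, hQc, hσK]; simp
  have hQcK : Q (c * K) = c * K * c * K := by rw [hQmul, hQK, hQc]; simp
  have hQ : Q (K * (K * c - c * K) * B) =
      K * (K * (c * K * c) - c * K * c * K) * B - K * (K * c - c * K) * K := by
    rw [hQmul, hQmul, hQK, hQB, map_sub, hQKc, hQcK]
    simp only [map_mul, map_sub, hσK, hσc]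
    noncomm_ring
  have hBc : B * c = 1 - c * B := eq_sub_of_add_eq' hcB
  have hBc' (x : A) : B * (c * x) = x - c * (B * x) := by
    rw [← mul_assoc, hBc, sub_mul, one_mul, mul_assoc]
  have hBK (x : A) : B * (K * x) = K * (B * x) := by
    rw [← mul_assoc, ← hKB, mul_assoc]
  have hcc' (x : A) : c * (c * x) = 0 := by rw [← mul_assoc, hcc, zero_mul]
  rw [hQ]
  simp only [mul_assoc, mul_sub, sub_mul, mul_add, add_mul, neg_mul, mul_neg, hBc, hBc', hBK,
    ← hKB, hBB, hcc', mul_zero, zero_mul, mul_one, sub_zero]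
  abel
end

section
/- In the abstract KBc algebra, with Ψ = −c·K − K·c + c·K·B·c (the MNT ghost brane) and ∂c := K·c − c·K, one has the exactness identity B·(∂c)·(∂c)·K = Q_Ψ(B·∂c·K) = Q(B·∂c·K) + Ψ·(B·∂c·K) − (B·∂c·K)·Ψ (the element B·∂c·K is even). -/
theorem stmt12 {A : Type*} [Ring A] [Algebra ℝ A]
    (σ : A →ₐ[ℝ] A) (hσ : ∀ x, σ (σ x) = x)
    (Q : A →ₗ[ℝ] A) (hQmul : ∀ x y, Q (x * y) = Q x * y + σ x * Q y)
    (K B c : A)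
    (hσK : σ K = K) (hσB : σ B = -B) (hσc : σ c = -c)
    (hKB : K * B = B * K) (hBB : B * B = 0) (hcc : c * c = 0)
    (hcB : c * B + B * c = 1)
    (hQK : Q K = 0) (hQB : Q B = K) (hQc : Q c = c * K * c) :
    B * (K * c - c * K) * (K * c - c * K) * K =
    Q (B * (K * c - c * K) * K) +
      (-(c * K) - K * c + c * K * B * c) * (B * (K * c - c * K) * K) -
      (B * (K * c - c * K) * K) * (-(c * K) - K * c + c * K * B * c) := by
  have hBc : B * c = 1 - c * B := eq_sub_of_add_eq' hcB
  have hBc_assoc (x : A) : B * (c * x) = x - c * (B * x) := by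
    rw [← mul_assoc, hBc, sub_mul, one_mul, mul_assoc]
  have hBK_assoc (x : A) : B * (K * x) = K * (B * x) := by
    rw [← mul_assoc, ← hKB, mul_assoc]
  have hcc_assoc (x : A) : c * (c * x) = 0 := by rw [← mul_assoc, hcc, zero_mul]
  simp only [hQmul, map_sub, hσK, hσc, hQK, hQB, hQc, mul_assoc, mul_sub, sub_mul,
    mul_add, add_mul, neg_mul, mul_neg, hBc, hBc_assoc, ← hKB, hBK_assoc, hBB,
    hcc_assoc, mul_zero, zero_mul, mul_one]
  abel
end

section
/- In the abstract KBc algebra, assume the auxiliary identities (∂^m c)·(∂^m c) = 0 for every integer m ≥ 1, where ∂x := K·x − x·K and ∂^m denotes the m-fold iterate of ∂. Then with Ψ = −c·K − K·c + c·K·B·c (the MNT ghost brane), the odd element ∂c·K·B·∂c is closed for the deformed kinetic operator: Q_Ψ(∂c·K·B·∂c) = Q(∂c·K·B·∂c) + Ψ·(∂c·K·B·∂c) + (∂c·K·B·∂c)·Ψ = 0. -/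
/-- An element of square zero anticommutes with its commutator with `K`. -/
theorem commutator_anticomm_of_sq_zero {A : Type*} [Ring A] {K x x' : A}
    (hx : x' = K * x - x * K) (h : x * x = 0) : x' * x + x * x' = 0 := by
  have : x' * x + x * x' = K * (x * x) - x * x * K := by
    subst hx
    noncomm_ring
  rw [this, h, mul_zero, zero_mul, sub_zero]

/-- Commutation with `K` is a derivation, so it preserves the anticommutation relation of `x` and `y`. -/
theorem anticomm_commutator {A : Type*} [Ring A] {K x y x' y' : A}
    (hx : x' = K * x - x * K) (hy : y' = K * y - y * K) (h : y * x + x * y = 0) :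
    (y' * x + x * y') + (y * x' + x' * y) = 0 := by
  have : (y' * x + x * y') + (y * x' + x' * y)
      = K * (y * x + x * y) - (y * x + x * y) * K := by
    subst hx hy
    noncomm_ring
  rw [this, h, mul_zero, zero_mul, sub_zero]

theorem stmt13 {A : Type*} [Ring A] [Algebra ℝ A]
    (σ : A →ₐ[ℝ] A) (hσ : ∀ x, σ (σ x) = x)
    (Q : A →ₗ[ℝ] A) (hQmul : ∀ x y, Q (x * y) = Q x * y + σ x * Q y)
    (K B c : A)
    (hσK : σ K = K) (hσB : σ B = -B) (hσc : σ c = -c)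
    (hKB : K * B = B * K) (hBB : B * B = 0) (hcc : c * c = 0)
    (hcB : c * B + B * c = 1)
    (hQK : Q K = 0) (hQB : Q B = K) (hQc : Q c = c * K * c)
    (haux : ∀ m : ℕ, 1 ≤ m →
      (fun x => K * x - x * K)^[m] c * (fun x => K * x - x * K)^[m] c = 0) :
    Q ((K * c - c * K) * K * B * (K * c - c * K)) +
      (-(c * K) - K * c + c * K * B * c) * ((K * c - c * K) * K * B * (K * c - c * K)) +
      ((K * c - c * K) * K * B * (K * c - c * K)) * (-(c * K) - K * c + c * K * B * c) = 0 := by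
  have hdd := haux 1 le_rfl
  have hee := haux 2 one_le_two
  simp only [Function.iterate_succ, Function.iterate_zero, Function.comp_apply, id_eq] at hdd hee
  obtain ⟨d, hd⟩ : ∃ d, d = K * c - c * K := ⟨_, rfl⟩
  rw [← hd] at hdd hee ⊢
  obtain ⟨e, he⟩ : ∃ e, e = K * d - d * K := ⟨_, rfl⟩
  rw [← he] at hee
  obtain ⟨f, hf⟩ : ∃ f, f = K * e - e * K := ⟨_, rfl⟩
  have hdc : d * c + c * d = 0 := commutator_anticomm_of_sq_zero hd hcc
  have hed : e * d + d * e = 0 := commutator_anticomm_of_sq_zero he hdd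
  have hec : e * c + c * e = 0 := by
    simpa [hdd] using anticomm_commutator hd he hdc
  have hfc : f * c + c * f = 0 := by
    simpa [hed] using anticomm_commutator hd hf hec
  have hfd : f * d + d * f = 0 := by
    simpa [hee] using anticomm_commutator he hf hed
  have hBc : B * c = 1 - c * B := eq_sub_of_add_eq' hcB
  have hBd : B * d = -(d * B) := by
    have : B * d = K * (B * c) - (B * c) * K := by
      rw [hd, mul_sub, ← mul_assoc, ← hKB, mul_assoc, mul_assoc]
    rw [this, hBc, hd, mul_sub, sub_mul, sub_mul, mul_assoc c B K, ← hKB]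
    noncomm_ring
  have hBe : B * e = -(e * B) := by
    have : B * e = K * (B * d) - (B * d) * K := by
      rw [he, mul_sub, ← mul_assoc, ← hKB, mul_assoc, mul_assoc]
    rw [this, hBd, he, neg_mul, sub_mul, mul_assoc d B K, ← hKB]
    noncomm_ring
  have hcK : c * K = K * c - d := by rw [hd]; abel
  have hdK : d * K = K * d - e := by rw [he]; abel
  have heK : e * K = K * e - f := by rw [hf]; abel
  replace hdc := eq_neg_of_add_eq_zero_left hdc
  replace hed := eq_neg_of_add_eq_zero_left hed
  replace hec := eq_neg_of_add_eq_zero_left hec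
  replace hfc := eq_neg_of_add_eq_zero_left hfc
  replace hfd := eq_neg_of_add_eq_zero_left hfd
  have hσd : σ d = -d := by
    rw [hd, map_sub, map_mul, map_mul, hσK, hσc]
    noncomm_ring
  have assoc {x y r : A} (h : x * y = r) (z : A) : x * (y * z) = r * z := by
    rw [← mul_assoc, h]
  have hQd : Q d = c * e := by
    have : Q d = K * (c * K * c) - c * K * c * K := by
      rw [hd, map_sub, hQmul, hQmul, hQK, hQc, hσK]
      simp
    rw [this]
    simp only [mul_assoc, mul_sub, sub_mul, mul_zero, neg_neg, sub_zero, zero_sub,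
      hcK, assoc hcK, hdK, hdc, hcc, hdd]
    abel
  have hQX : Q (d * K * B * d) = c * e * K * B * d - d * K * K * d + d * K * B * (c * e) := by
    simp only [hQmul, hQd, hQK, hQB, map_mul, hσd, hσK, hσB]
    noncomm_ring
  rw [hQX]
  simp only [mul_assoc, mul_sub, sub_mul, mul_add, add_mul, mul_neg, neg_mul, mul_zero, zero_mul,
    mul_one, one_mul, neg_neg, sub_zero, zero_sub, neg_zero,
    hcK, assoc hcK, hdK, assoc hdK, heK, assoc heK, assoc hKB.symm,
    hBc, assoc hBc, hBd, assoc hBd, hBe, assoc hBe, hBB,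
    assoc hdc, assoc hec, hed, assoc hed, assoc hfc, hfd, assoc hfd,
    assoc hcc, hdd, assoc hdd, hee, assoc hee]
  abel
end

section
/- In the abstract KBc algebra, the identity-based tachyon vacuum Ψ = c·(1 − K) satisfies the equation of motion Q(Ψ) + Ψ·Ψ = 0. -/
theorem stmt17 {A : Type*} [Ring A] [Algebra ℝ A]
    (σ : A →ₐ[ℝ] A) (hσ : ∀ x, σ (σ x) = x)
    (Q : A →ₗ[ℝ] A) (hQmul : ∀ x y, Q (x * y) = Q x * y + σ x * Q y)
    (K B c : A)
    (hσK : σ K = K) (hσB : σ B = -B) (hσc : σ c = -c)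
    (hKB : K * B = B * K) (hBB : B * B = 0) (hcc : c * c = 0)
    (hcB : c * B + B * c = 1)
    (hQK : Q K = 0) (hQB : Q B = K) (hQc : Q c = c * K * c) :
    Q (c * (1 - K)) + c * (1 - K) * (c * (1 - K)) = 0 := by
  have hQ1 : Q 1 = 0 := by simpa using hQmul 1 1
  have hsq : c * (1 - K) * (c * (1 - K)) = -(c * K * c * (1 - K)) := by
    rw [← mul_assoc, mul_sub c 1 K, mul_one, sub_mul c, hcc, zero_sub, neg_mul]
  rw [hQmul, hQc, map_sub, hQ1, hQK, sub_zero, mul_zero, add_zero, hsq, add_neg_cancel]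
end

section
/- In the abstract KBc algebra, assume additionally that 1 + K is invertible and that σ((1+K)⁻¹) = (1+K)⁻¹. Then the 'simple' tachyon vacuum Ψ = (c + c·K·B·c)·(1+K)⁻¹ satisfies the equation of motion Q(Ψ) + Ψ·Ψ = 0; moreover Ψ = (c + Q(B·c))·(1+K)⁻¹. -/
theorem stmt18 {A : Type*} [Ring A] [Algebra ℝ A]
    (σ : A →ₐ[ℝ] A) (hσ : ∀ x, σ (σ x) = x)
    (Q : A →ₗ[ℝ] A) (hQmul : ∀ x y, Q (x * y) = Q x * y + σ x * Q y)
    (K B c : A)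
    (hσK : σ K = K) (hσB : σ B = -B) (hσc : σ c = -c)
    (hKB : K * B = B * K) (hBB : B * B = 0) (hcc : c * c = 0)
    (hcB : c * B + B * c = 1)
    (hQK : Q K = 0) (hQB : Q B = K) (hQc : Q c = c * K * c)
    (J : A) (hJ : (1 + K) * J = 1) (hJ' : J * (1 + K) = 1) (hσJ : σ J = J) :
    Q ((c + c * K * B * c) * J) +
      (c + c * K * B * c) * J * ((c + c * K * B * c) * J) = 0 ∧
    (c + c * K * B * c) * J = (c + Q (B * c)) * J := by
  have hQ1 : Q 1 = 0 := by
    have h := hQmul 1 1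
    simp only [mul_one, one_mul, map_one] at h
    exact left_eq_add.mp h
  have hQJ : Q J = 0 := by
    have h := hQmul J (1 + K)
    rw [hJ', hQ1, map_add, hQ1, hQK, add_zero, mul_zero, add_zero] at h
    calc Q J = Q J * (1 + K) * J := by rw [mul_assoc, hJ, mul_one]
      _ = 0 := by rw [← h, zero_mul]
  have hcBc : c * B * c = c := by
    rw [eq_sub_of_add_eq hcB, sub_mul, one_mul, mul_assoc, hcc, mul_zero, sub_zero]
  have hBcB : B * c * B = B := by
    rw [mul_assoc, eq_sub_of_add_eq hcB, mul_sub, mul_one, ← mul_assoc, hBB, zero_mul, sub_zero]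
  have hJB : J * B = B * J := by
    have h : (1 + K) * B = B * (1 + K) := by rw [add_mul, mul_add, hKB, one_mul, mul_one]
    calc J * B = J * (B * (1 + K)) * J := by rw [mul_assoc, mul_assoc, hJ, mul_one]
      _ = B * J := by rw [← h, ← mul_assoc, hJ', one_mul]
  have hQBc : Q (B * c) = K * c - B * c * K * c := by
    rw [hQmul, hQB, hσB, hQc]; noncomm_ring
  have hX : c + c * K * B * c = c + Q (B * c) := by
    rw [hQBc, mul_assoc c K B, hKB, ← mul_assoc, eq_sub_of_add_eq hcB]
    noncomm_ring
  have hQcKc : Q (c * K * c) = 0 := by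
    simp only [hQmul, hQc, hQK, map_mul, hσc, hσK]
    noncomm_ring
  have hQX : Q (c + c * K * B * c) = c * K * c := by
    have h : Q (B * c) = K * c - B * (c * K * c) := by rw [hQBc]; noncomm_ring
    have h' : Q (Q (B * c)) = 0 := by
      rw [h, map_sub, hQmul, hQmul B, hQK, hσK, hQc, hQB, hQcKc]; noncomm_ring
    rw [hX, map_add, h', hQc, add_zero]
  have hX' : c + c * K * B * c = c * (1 + K) * (B * c) := by
    calc c + c * K * B * c = c * B * c + c * K * B * c := by rw [hcBc]
      _ = _ := by noncomm_ring
  have hX'' : c + c * K * B * c = c * B * ((1 + K) * c) := by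
    calc c + c * K * B * c = c * B * c + c * (K * B) * c := by rw [hcBc, mul_assoc c K B]
      _ = _ := by rw [hKB]; noncomm_ring
  have hmid : B * c * J * (c * B) = J * c * B - c * B * J := by
    calc B * c * J * (c * B) = (1 - c * B) * J * (c * B) := by
          rw [← hcB, add_sub_cancel_left]
      _ = J * c * B - c * (B * J) * (c * B) := by noncomm_ring
      _ = J * c * B - c * J * (B * c * B) := by rw [← hJB]; noncomm_ring
      _ = J * c * B - c * (J * B) := by rw [hBcB, mul_assoc c J B]
      _ = _ := by rw [hJB, mul_assoc c B J]
  have hXJX : (c + c * K * B * c) * J * (c + c * K * B * c) = -(c * K * c) := by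
    calc (c + c * K * B * c) * J * (c + c * K * B * c)
        = c * (1 + K) * (B * c) * J * (c * B * ((1 + K) * c)) := by rw [← hX', ← hX'']
      _ = c * (1 + K) * (B * c * J * (c * B)) * ((1 + K) * c) := by noncomm_ring
      _ = c * ((1 + K) * J) * c * B * ((1 + K) * c)
          - c * (1 + K) * c * B * (J * (1 + K)) * c := by rw [hmid]; noncomm_ring
      _ = c * c * B * ((1 + K) * c) - (c * c) * B * c - c * K * (c * B * c) := by
          rw [hJ, hJ']; noncomm_ring
      _ = _ := by rw [hcc, hcBc]; noncomm_ring
  refine ⟨?_, by rw [hX]⟩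
  rw [hQmul, hQX, hQJ, mul_zero, add_zero, ← mul_assoc, hXJX, neg_mul, add_neg_cancel]
end

section
/- In the abstract KBc algebra, assume additionally that K is invertible and that σ(K⁻¹) = K⁻¹. Then the homotopy operator A := B·K⁻¹ satisfies Q(A) = 1, and consequently the Q-cohomology of the algebra is trivial: every x ∈ A with Q(x) = 0 satisfies x = Q(B·K⁻¹·x). -/
theorem stmt19 {A : Type*} [Ring A] [Algebra ℝ A]
    (σ : A →ₐ[ℝ] A) (hσ : ∀ x, σ (σ x) = x)
    (Q : A →ₗ[ℝ] A) (hQmul : ∀ x y, Q (x * y) = Q x * y + σ x * Q y)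
    (K B c : A)
    (hσK : σ K = K) (hσB : σ B = -B) (hσc : σ c = -c)
    (hKB : K * B = B * K) (hBB : B * B = 0) (hcc : c * c = 0)
    (hcB : c * B + B * c = 1)
    (hQK : Q K = 0) (hQB : Q B = K) (hQc : Q c = c * K * c)
    (Ki : A) (hKi : K * Ki = 1) (hKi' : Ki * K = 1) (hσKi : σ Ki = Ki) :
    Q (B * Ki) = 1 ∧ ∀ x : A, Q x = 0 → x = Q (B * Ki * x) := by
  have hQ1 : Q 1 = 0 := by simpa using hQmul 1 1
  have hKQ : K * Q Ki = 0 := by simpa [hKi, hQ1, hQK, hσK] using (hQmul K Ki).symm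
  have hQKi : Q Ki = 0 := by rw [← one_mul (Q Ki), ← hKi', mul_assoc, hKQ, mul_zero]
  have hQA : Q (B * Ki) = 1 := by rw [hQmul, hQB, hQKi, hKi, mul_zero, add_zero]
  exact ⟨hQA, fun x hx => by rw [hQmul, hQA, hx, one_mul, mul_zero, add_zero]⟩
end
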